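/- Let L : ℝⁿ × ℝⁿ → ℝ be smooth with arguments (x, v), and suppose L is strongly convex in v: for every (x, v), the Hessian of v ↦ L(x, v) is positive definite. For each x let Φ_{L_x}(v) = ∇_v L(x, v) be the fiberwise Legendre transform and let H(x, ξ) = ⟨ξ, Φ_{L_x}⁻¹(ξ)⟩ − L(x, Φ_{L_x}⁻¹(ξ)) be the induced Hamiltonian, defined for ξ in the image of Φ_{L_x}. If γ : ℝ → ℝⁿ is a twice differentiable curve satisfying the Euler–Lagrange equations for L, then the curve Ψ(t) = (γ(t), ξ(t)) with ξ(t) = ∇_v L(γ(t), γ'(t)) satisfies Hamilton's equations for H: (γⁱ)'(t) = (∂H/∂ξ_i)(Ψ(t)) and (ξ_i)'(t) = −(∂H/∂xⁱ)(Ψ(t)) for all i and t. -/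

import Mathlib

open scoped RealInnerProductSpace

section Legendre

variable {E : Type*} [NormedAddCommGroup E] [InnerProductSpace ℝ E]

theorem fderiv_fiber_eq {L : E × E → ℝ} (hL : Differentiable ℝ L) (x v : E) :
    fderiv ℝ (fun w => L (x, w)) v = (fderiv ℝ L (x, v)).comp (ContinuousLinearMap.inr ℝ E E) :=
  ((hL (x, v)).hasFDerivAt.comp v (hasFDerivAt_prodMk_right x v)).fderiv

variable [CompleteSpace E]

theorem inner_gradient_fiber {L : E × E → ℝ} (hL : Differentiable ℝ L) (x v u : E) :
    ⟪gradient (fun w => L (x, w)) v, u⟫ = fderiv ℝ L (x, v) (0, u) := by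
  simp [gradient, fderiv_fiber_eq hL]

theorem contDiff_gradient_fiber {L : E × E → ℝ} (hL : ContDiff ℝ 2 L) :
    ContDiff ℝ 1 fun p : E × E => gradient (fun w => L (p.1, w)) p.2 := by
  have hd : Differentiable ℝ L := hL.differentiable (by norm_num)
  simp only [gradient, fderiv_fiber_eq hd]
  exact (InnerProductSpace.toDual ℝ E).symm.contDiff.comp
    ((hL.fderiv_right (m := 1) (by norm_num)).clm_comp contDiff_const)

theorem inner_fderiv_gradient_fiber {L : E × E → ℝ} (hL : ContDiff ℝ 2 L) (x v u w : E) :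
    ⟪fderiv ℝ (fun p : E × E => gradient (fun w => L (p.1, w)) p.2) (x, v) (0, u), w⟫
      = fderiv ℝ (fderiv ℝ fun w => L (x, w)) v u w := by
  have hP := ((contDiff_gradient_fiber hL).differentiable (by norm_num) (x, v)).hasFDerivAt.comp v
    (hasFDerivAt_prodMk_right x v)
  have hQ := (InnerProductSpace.toDual ℝ E).toContinuousLinearEquiv.hasFDerivAt.comp v hP
  have heq : (fderiv ℝ fun w => L (x, w)) = (InnerProductSpace.toDual ℝ E).toContinuousLinearEquiv ∘
      ((fun p : E × E => gradient (fun w => L (p.1, w)) p.2) ∘ fun w => (x, w)) := by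
    funext y
    simp [gradient]
  rw [heq, hQ.fderiv]
  simp

/-- The derivative of the Hamiltonian induced by a fiberwise strongly convex Lagrangian, at the
image of `(x, v)` under the Legendre transform, is `(a, b) ↦ ⟪v, b⟫ - ∂ₓL(x, v) a`. -/
theorem hasFDerivAt_hamiltonian [FiniteDimensional ℝ E] {L H : E × E → ℝ} (hL : ContDiff ℝ 2 L)
    (hconv : ∀ x v u : E, u ≠ 0 → 0 < fderiv ℝ (fderiv ℝ fun w => L (x, w)) v u u)
    (hH : ∀ x v : E, H (x, gradient (fun w => L (x, w)) v)
      = ⟪gradient (fun w => L (x, w)) v, v⟫ - L (x, v)) (x v : E) :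
    HasFDerivAt H ((innerSL ℝ v).comp (ContinuousLinearMap.snd ℝ E E) -
      (fderiv ℝ L (x, v)).comp
        ((ContinuousLinearMap.inl ℝ E E).comp (ContinuousLinearMap.fst ℝ E E)))
      (x, gradient (fun w => L (x, w)) v) := by
  have hd : Differentiable ℝ L := hL.differentiable (by norm_num)
  set P : E × E → E := fun p => gradient (fun w => L (p.1, w)) p.2
  have hP : HasStrictFDerivAt P (fderiv ℝ P (x, v)) (x, v) :=
    (contDiff_gradient_fiber hL).contDiffAt.hasStrictFDerivAt (by norm_num)
  set T : E × E →L[ℝ] E × E := (ContinuousLinearMap.fst ℝ E E).prod (fderiv ℝ P (x, v)) with hT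
  have hinj : Function.Injective T := by
    rw [injective_iff_map_eq_zero]
    rintro ⟨a, u⟩ h
    obtain ⟨rfl, hu⟩ : a = 0 ∧ fderiv ℝ P (x, v) (a, u) = 0 := by simpa [hT] using h
    by_contra hne
    have hpos := hconv x v u (by simpa using hne)
    rw [← inner_fderiv_gradient_fiber hL, hu, inner_zero_left] at hpos
    exact hpos.false
  let e : (E × E) ≃L[ℝ] (E × E) :=
    (LinearEquiv.ofInjectiveEndo T.toLinearMap hinj).toContinuousLinearEquiv
  have he : (e : E × E →L[ℝ] E × E) = T := by ext p <;> rfl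
  let F : E × E → E × E := fun p => (p.1, P p)
  have hF : HasStrictFDerivAt F (e : E × E →L[ℝ] E × E) (x, v) := by
    rw [he]
    exact hasStrictFDerivAt_fst.prodMk hP
  have hG := (hP.hasFDerivAt.inner ℝ (hasFDerivAt_snd (𝕜 := ℝ) (p := (x, v)))).sub
    (hd (x, v)).hasFDerivAt
  have hloc : hF.localInverse F e (x, v) (F (x, v)) = (x, v) := hF.localInverse_apply_image
  have hHd := (HasFDerivAt.comp (F (x, v)) (hloc.symm ▸ hG)
    hF.to_localInverse.hasFDerivAt).congr_of_eventuallyEq (f₁ := H) (by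
      filter_upwards [hF.eventually_right_inverse] with q hq
      conv_lhs => rw [← hq]
      exact hH _ _)
  refine hHd.congr_fderiv (ContinuousLinearMap.ext fun q => ?_)
  obtain ⟨⟨a, u⟩, rfl⟩ := e.surjective q
  have hes : e (a, u) = (a, fderiv ℝ P (x, v) (a, u)) := rfl
  have hsymm : e.symm (a, fderiv ℝ P (x, v) (a, u)) = (a, u) := e.symm_apply_apply (a, u)
  have hsplit : fderiv ℝ L (x, v) (a, u) = fderiv ℝ L (x, v) (a, 0) + fderiv ℝ L (x, v) (0, u) := by
    rw [← map_add]
    simp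
  have hPu : ⟪P (x, v), u⟫ = fderiv ℝ L (x, v) (0, u) := inner_gradient_fiber hd x v u
  rw [hloc]
  simp only [hes]
  simp [fderivInnerCLM_apply, hsymm, hPu, hsplit, real_inner_comm]
  ring

end Legendre

/-- The fiberwise Legendre transform takes solutions of the Euler–Lagrange
equations for a Lagrangian `L(x, v)`, strongly convex in `v`, to solutions of
Hamilton's equations for the induced Hamiltonian
`H(x, ξ) = ⟨ξ, Φ_{L_x}⁻¹(ξ)⟩ - L(x, Φ_{L_x}⁻¹(ξ))`. -/
theorem eulerLagrange_to_hamilton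
    (n : ℕ)
    (L : EuclideanSpace ℝ (Fin n) × EuclideanSpace ℝ (Fin n) → ℝ)
    (hL : ContDiff ℝ (⊤ : ℕ∞) L)
    (hconv : ∀ x v u : EuclideanSpace ℝ (Fin n), u ≠ 0 →
      0 < fderiv ℝ (fderiv ℝ fun w => L (x, w)) v u u)
    (H : EuclideanSpace ℝ (Fin n) × EuclideanSpace ℝ (Fin n) → ℝ)
    (hH : ∀ x v : EuclideanSpace ℝ (Fin n),
      H (x, gradient (fun w => L (x, w)) v)
        = ⟪gradient (fun w => L (x, w)) v, v⟫ - L (x, v))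
    (γ : ℝ → EuclideanSpace ℝ (Fin n))
    (hγ : Differentiable ℝ γ) (hγ' : Differentiable ℝ (deriv γ))
    (hEL : ∀ (i : Fin n) (t : ℝ),
      HasDerivAt (fun s => fderiv ℝ L (γ s, deriv γ s) (0, EuclideanSpace.single i 1))
        (fderiv ℝ L (γ t, deriv γ t) (EuclideanSpace.single i 1, 0)) t) :
    ∀ (i : Fin n) (t : ℝ),
      HasDerivAt (fun s => γ s i)
        (fderiv ℝ H (γ t, gradient (fun w => L (γ t, w)) (deriv γ t))
          (0, EuclideanSpace.single i 1)) t ∧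
      HasDerivAt (fun s => gradient (fun w => L (γ s, w)) (deriv γ s) i)
        (-(fderiv ℝ H (γ t, gradient (fun w => L (γ t, w)) (deriv γ t))
          (EuclideanSpace.single i 1, 0))) t := by
  intro i t
  have hd : Differentiable ℝ L := hL.differentiable (by simp)
  have hL2 : ContDiff ℝ 2 L := contDiff_infty.1 hL 2
  have hHd := hasFDerivAt_hamiltonian hL2 hconv hH (γ t) (deriv γ t)
  rw [hHd.fderiv]
  constructor
  · have h := (EuclideanSpace.proj (𝕜 := ℝ) i).hasFDerivAt.comp_hasDerivAt t (hγ t).hasDerivAt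
    have h0 : fderiv ℝ L (γ t, deriv γ t) (0, 0) = 0 := map_zero _
    simpa [Function.comp_def, EuclideanSpace.inner_single_right, h0] using h
  · have hξ : (fun s => gradient (fun w => L (γ s, w)) (deriv γ s) i) =
        fun s => fderiv ℝ L (γ s, deriv γ s) (0, EuclideanSpace.single i 1) := by
      funext s
      rw [← inner_gradient_fiber hd, EuclideanSpace.inner_single_right]
      simp
    rw [hξ]
    simpa using hEL i t
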